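/- (Conformal null case, eigenspace decomposition of ad(A) on g₋₁.) Let Z ∈ (ℝⁿ)* be a nonzero row covector with ⟨Z,Z⟩ = 0 and let X ∈ ℝⁿ be a column vector with Z⬝X = 1 and ⟨X,X⟩ = 0; set A = ⁅ι₊(Z), ι₋(X)⁆. Then: (i) ⁅A, ι₋(X)⁆ = −2 ι₋(X); (ii) ⁅A, ι₋(IZᵀ)⁆ = 0; (iii) ⁅A, ι₋(Y)⁆ = −ι₋(Y) for every Y ∈ ℝⁿ with Z⬝Y = 0 and ⟨X,Y⟩ = 0. Moreover ℝⁿ is the (internal) direct sum of the line ℝ·X, the line ℝ·IZᵀ, and the subspace {Y : Z⬝Y = 0 and ⟨X,Y⟩ = 0}. -/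

import Mathlib

open Matrix

/-- Index type for (n+2)×(n+2) block matrices with blocks of sizes 1, n, 1. -/
abbrev Idx (n : ℕ) := Unit ⊕ Fin n ⊕ Unit

/-- The diagonal entries of the signature matrix I = diag(Id_p, −Id_q). -/
def sig (p q : ℕ) : Fin (p + q) → ℝ := fun i => if (i : ℕ) < p then 1 else -1

/-- The n×n signature matrix I = diag(Id_p, −Id_q). -/
def sigMat (p q : ℕ) : Matrix (Fin (p + q)) (Fin (p + q)) ℝ := Matrix.diagonal (sig p q)

/-- The inner product of signature (p,q): ⟨X,Y⟩ = Xᵀ I Y (the same formula gives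
Z I Wᵀ for row covectors). -/
def form (p q : ℕ) (X Y : Fin (p + q) → ℝ) : ℝ := ∑ i, X i * sig p q i * Y i

/-- The column vector I Zᵀ associated to a row covector Z (written `starr`) (equally, the row covector
Xᵀ I associated to a column vector X). -/
def iFlip (p q : ℕ) (Z : Fin (p + q) → ℝ) : Fin (p + q) → ℝ := fun i => sig p q i * Z i

/-- Embedding of g₋₁ ≅ ℝⁿ into so(p+1,q+1): (2,1)-block X, (3,2)-block −XᵀI. -/
def iotaMinus (p q : ℕ) (X : Fin (p + q) → ℝ) : Matrix (Idx (p + q)) (Idx (p + q)) ℝ :=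
  Matrix.of fun i j =>
    match i, j with
    | Sum.inr (Sum.inl i), Sum.inl _ => X i
    | Sum.inr (Sum.inr _), Sum.inr (Sum.inl j) => -(X j * sig p q j)
    | _, _ => 0

/-- Embedding of g₁ ≅ (ℝⁿ)* into so(p+1,q+1): (1,2)-block Z, (2,3)-block −IZᵀ. -/
def iotaPlus (p q : ℕ) (Z : Fin (p + q) → ℝ) : Matrix (Idx (p + q)) (Idx (p + q)) ℝ :=
  Matrix.of fun i j =>
    match i, j with
    | Sum.inl _, Sum.inr (Sum.inl j) => Z j
    | Sum.inr (Sum.inl i), Sum.inr (Sum.inr _) => -(sig p q i * Z i)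
    | _, _ => 0

/-- Embedding of g₀ into so(p+1,q+1): block diagonal matrix diag(a, A, −a). -/
def iotaZero (p q : ℕ) (A : Matrix (Fin (p + q)) (Fin (p + q)) ℝ) (a : ℝ) :
    Matrix (Idx (p + q)) (Idx (p + q)) ℝ :=
  Matrix.of fun i j =>
    match i, j with
    | Sum.inl _, Sum.inl _ => a
    | Sum.inr (Sum.inl i), Sum.inr (Sum.inl j) => A i j
    | Sum.inr (Sum.inr _), Sum.inr (Sum.inr _) => -a
    | _, _ => 0

lemma sig_mul_self (p q : ℕ) (i : Fin (p + q)) : sig p q i * sig p q i = 1 := by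
  unfold sig
  split_ifs <;> norm_num

lemma form_eq_dotProduct (p q : ℕ) (X Y : Fin (p + q) → ℝ) :
    form p q X Y = iFlip p q X ⬝ᵥ Y :=
  Finset.sum_congr rfl fun i _ => by rw [iFlip, mul_comm (X i)]

lemma iotaMinus_smul (p q : ℕ) (c : ℝ) (X : Fin (p + q) → ℝ) :
    iotaMinus p q (c • X) = c • iotaMinus p q X := by
  ext (i | i | i) (j | j | j) <;> simp [iotaMinus, mul_assoc]

lemma iotaMinus_zero (p q : ℕ) : iotaMinus p q 0 = 0 := by
  simpa using iotaMinus_smul p q 0 0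

/-- The bracket of `g₁` with `g₋₁` lands in `g₀`. -/
lemma lie_iotaPlus_iotaMinus (p q : ℕ) (Z X : Fin (p + q) → ℝ) :
    ⁅iotaPlus p q Z, iotaMinus p q X⁆ =
      iotaZero p q
        (vecMulVec (iFlip p q Z) (iFlip p q X) - vecMulVec X Z) (∑ i, Z i * X i) := by
  rw [Ring.lie_def]
  ext (i | i | i) (j | j | j) <;>
    simp [Matrix.mul_apply, iotaPlus, iotaMinus, iotaZero, iFlip, vecMulVec_apply,
      Fintype.sum_sum_type]
  · exact Or.inl (mul_comm _ _)
  · refine Finset.sum_congr rfl fun k _ => ?_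
    linear_combination X k * Z k * sig_mul_self p q k

/-- The action of `⁅g₁, g₋₁⁆` on `g₋₁`. -/
lemma lie_lie_iotaMinus (p q : ℕ) (Z X Y : Fin (p + q) → ℝ) :
    ⁅⁅iotaPlus p q Z, iotaMinus p q X⁆, iotaMinus p q Y⁆ =
      iotaMinus p q (form p q X Y • iFlip p q Z - (∑ i, Z i * Y i) • X
        - (∑ i, Z i * X i) • Y) := by
  rw [lie_iotaPlus_iotaMinus, Ring.lie_def]
  ext (i | i | i) (j | j | j) <;>
    simp [Matrix.mul_apply, iotaMinus, iotaZero, iFlip, vecMulVec_apply, form,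
      Fintype.sum_sum_type]
  · have h : ∑ k, (sig p q i * Z i * (sig p q k * X k) - X i * Z k) * Y k =
        (∑ k, X k * sig p q k * Y k) * (sig p q i * Z i) - (∑ k, Z k * Y k) * X i := by
      simp only [Finset.sum_mul, ← Finset.sum_sub_distrib]
      exact Finset.sum_congr rfl fun k _ => by ring
    linear_combination h
  · have h : ∑ k, Y k * sig p q k * (sig p q k * Z k * (sig p q j * X j) - X k * Z j) =
        (∑ k, Z k * Y k) * (sig p q j * X j) - (∑ k, X k * sig p q k * Y k) * Z j := by
      simp only [Finset.sum_mul, ← Finset.sum_sub_distrib]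
      refine Finset.sum_congr rfl fun k _ => ?_
      linear_combination Y k * Z k * (sig p q j * X j) * sig_mul_self p q k
    linear_combination h + (∑ k, X k * sig p q k * Y k) * Z j * sig_mul_self p q j

/-- Three submodules form an internal direct sum once every vector decomposes along them and the
only decomposition of zero is the trivial one. -/
lemma isInternal_fin_three {R M : Type*} [Ring R] [AddCommGroup M] [Module R M]
    (A : Fin 3 → Submodule R M)
    (hind : ∀ a ∈ A 0, ∀ b ∈ A 1, ∀ c ∈ A 2, a + b + c = 0 → a = 0 ∧ b = 0 ∧ c = 0)
    (hspan : ∀ v, ∃ a ∈ A 0, ∃ b ∈ A 1, ∃ c ∈ A 2, a + b + c = v) :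
    DirectSum.IsInternal A := by
  rw [DirectSum.isInternal_submodule_iff_iSupIndep_and_iSup_eq_top]
  constructor
  · classical
    refine iSupIndep_of_dfinsupp_lsum_injective _ ((injective_iff_map_eq_zero _).2 fun x hx => ?_)
    have hx' : (x 0 : M) + x 1 + x 2 = 0 := by
      rw [← hx, DFinsupp.lsum_apply_apply, DFinsupp.sumAddHom_apply,
        DFinsupp.sum_eq_sum_fintype _ (by simp), Fin.sum_univ_three]
      rfl
    obtain ⟨h0, h1, h2⟩ := hind _ (x 0).2 _ (x 1).2 _ (x 2).2 hx'
    ext i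
    fin_cases i
    exacts [h0, h1, h2]
  · refine eq_top_iff.2 fun v _ => ?_
    obtain ⟨a, ha, b, hb, c, hc, rfl⟩ := hspan v
    exact add_mem (add_mem (Submodule.mem_iSup_of_mem 0 ha) (Submodule.mem_iSup_of_mem 1 hb))
      (Submodule.mem_iSup_of_mem 2 hc)

/-- Conformal null case, eigenspace decomposition of ad(A) on g₋₁:
for Z ≠ 0 null, X with Z⬝X = 1 and ⟨X,X⟩ = 0, and A = ⁅ι₊(Z), ι₋(X)⁆:
(i) ⁅A, ι₋(X)⁆ = −2ι₋(X); (ii) ⁅A, ι₋(IZᵀ)⁆ = 0; (iii) ⁅A, ι₋(Y)⁆ = −ι₋(Y)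
whenever Z⬝Y = 0 and ⟨X,Y⟩ = 0; moreover ℝⁿ is the internal direct sum of the lines
ℝ·X and ℝ·IZᵀ and the subspace {Y : Z⬝Y = 0 and ⟨X,Y⟩ = 0}. -/
theorem conformal_null_eigen_decomp (p q : ℕ) (hn : 3 ≤ p + q) (Z : Fin (p + q) → ℝ)
    (hZ : Z ≠ 0) (hnull : form p q Z Z = 0) (X : Fin (p + q) → ℝ)
    (hZX : (∑ i, Z i * X i) = 1) (hXX : form p q X X = 0) :
    ⁅⁅iotaPlus p q Z, iotaMinus p q X⁆, iotaMinus p q X⁆ = (-2 : ℝ) • iotaMinus p q X ∧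
    ⁅⁅iotaPlus p q Z, iotaMinus p q X⁆, iotaMinus p q (iFlip p q Z)⁆ = 0 ∧
    (∀ Y : Fin (p + q) → ℝ, (∑ i, Z i * Y i) = 0 → form p q X Y = 0 →
      ⁅⁅iotaPlus p q Z, iotaMinus p q X⁆, iotaMinus p q Y⁆ = -(iotaMinus p q Y)) ∧
    DirectSum.IsInternal
      (![Submodule.span ℝ {X}, Submodule.span ℝ {iFlip p q Z},
         LinearMap.ker (∑ i, Z i • (LinearMap.proj i : (Fin (p + q) → ℝ) →ₗ[ℝ] ℝ)) ⊓
         LinearMap.ker (∑ i, (X i * sig p q i) •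
            (LinearMap.proj i : (Fin (p + q) → ℝ) →ₗ[ℝ] ℝ))] :
        Fin 3 → Submodule ℝ (Fin (p + q) → ℝ)) := by
  have hIZ : ∑ i, Z i * iFlip p q Z i = 0 := by
    rw [← hnull]
    exact Finset.sum_congr rfl fun i _ => by simp only [iFlip]; ring
  have hXZ : form p q X (iFlip p q Z) = 1 := by
    rw [← hZX]
    refine Finset.sum_congr rfl fun i _ => ?_
    simp only [iFlip]
    linear_combination X i * Z i * sig_mul_self p q i
  have hmem : ∀ Y, Y ∈ LinearMap.ker
        (∑ i, Z i • (LinearMap.proj i : (Fin (p + q) → ℝ) →ₗ[ℝ] ℝ)) ⊓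
      LinearMap.ker (∑ i, (X i * sig p q i) •
        (LinearMap.proj i : (Fin (p + q) → ℝ) →ₗ[ℝ] ℝ)) ↔
      Z ⬝ᵥ Y = 0 ∧ form p q X Y = 0 := fun Y => by
    simp [form, dotProduct]
  simp only [form_eq_dotProduct] at *
  change Z ⬝ᵥ X = 1 at hZX
  change Z ⬝ᵥ iFlip p q Z = 0 at hIZ
  refine ⟨?_, ?_, fun Y hY hXY => ?_, isInternal_fin_three _ ?_ fun v => ?_⟩
  · rw [lie_lie_iotaMinus, ← iotaMinus_smul, form_eq_dotProduct, hXX]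
    change iotaMinus p q (_ - (Z ⬝ᵥ X) • X - (Z ⬝ᵥ X) • X) = _
    rw [hZX]
    congr 1
    module
  · rw [lie_lie_iotaMinus, ← iotaMinus_zero, form_eq_dotProduct, hXZ]
    change iotaMinus p q (_ - (Z ⬝ᵥ iFlip p q Z) • X - (Z ⬝ᵥ X) • iFlip p q Z) = _
    rw [hZX, hIZ]
    congr 1
    module
  · change Z ⬝ᵥ Y = 0 at hY
    rw [lie_lie_iotaMinus, ← neg_one_smul ℝ (iotaMinus p q Y), ← iotaMinus_smul,
      form_eq_dotProduct, hXY]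
    change iotaMinus p q (_ - (Z ⬝ᵥ Y) • X - (Z ⬝ᵥ X) • Y) = _
    rw [hZX, hY]
    congr 1
    module
  · intro a ha b hb c hc h
    obtain ⟨r, rfl⟩ := Submodule.mem_span_singleton.1 ha
    obtain ⟨s, rfl⟩ := Submodule.mem_span_singleton.1 hb
    obtain ⟨hc1, hc2⟩ := (hmem c).1 hc
    have hr := congrArg (Z ⬝ᵥ ·) h
    have hs := congrArg (iFlip p q X ⬝ᵥ ·) h
    simp only [dotProduct_add, dotProduct_smul, dotProduct_zero, smul_eq_mul, hZX, hIZ, hXX, hXZ,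
      hc1, hc2] at hr hs
    obtain rfl : r = 0 := by linarith
    obtain rfl : s = 0 := by linarith
    simpa using h
  · refine ⟨(Z ⬝ᵥ v) • X, Submodule.smul_mem _ _ (Submodule.mem_span_singleton_self _),
      (iFlip p q X ⬝ᵥ v) • iFlip p q Z,
      Submodule.smul_mem _ _ (Submodule.mem_span_singleton_self _),
      v - (Z ⬝ᵥ v) • X - (iFlip p q X ⬝ᵥ v) • iFlip p q Z, (hmem _).2 ⟨?_, ?_⟩, by abel⟩ <;>
    simp [dotProduct_sub, *]
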